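/- arXiv:2212.13111 — 2 statements merged into one kernel-verified Lean document; each statement's English description precedes it below -/
import Mathlib

section
/- In the clipping ANN setting, the risk function L : ℝ^{h+1} → ℝ is continuously differentiable, and for every θ = (θ_1, …, θ_{h+1}) ∈ ℝ^{h+1} it holds that (i) for every i ∈ {1, …, h}, (∂/∂θ_i L)(θ) = 2 v_i ∫_a^b (N^θ(x) − f(x)) p(x) 1_{(0,1)}(w_i x + θ_i) dx = 2 v_i ∫_{I_i^θ} (N^θ(x) − f(x)) p(x) dx, and (ii) (∂/∂θ_{h+1} L)(θ) = 2 ∫_a^b (N^θ(x) − f(x)) p(x) dx. -/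
open MeasureTheory Filter

noncomputable section

/-- The clipping function `x ↦ min{max{x,0},1}`. -/
def clipFn (x : ℝ) : ℝ := min (max x 0) 1

/-- `ψ_i(θ) = -θ_i / w_i`. -/
def psiC {h : ℕ} (w : Fin h → ℝ) (θ : Fin (h + 1) → ℝ) (i : Fin h) : ℝ :=
  -θ i.castSucc / w i

/-- The activity interval `I_i^θ = (ψ_i(θ), ψ_i(θ) + 1/w_i) ∩ (a, b)`. -/
def actI {h : ℕ} (a b : ℝ) (w : Fin h → ℝ) (θ : Fin (h + 1) → ℝ) (i : Fin h) : Set ℝ :=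
  Set.Ioo (psiC w θ i) (psiC w θ i + (w i)⁻¹) ∩ Set.Ioo a b

/-- The realization function `N^θ(x) = θ_{h+1} + ∑_i v_i c(w_i x + θ_i)`. -/
def realC {h : ℕ} (v w : Fin h → ℝ) (θ : Fin (h + 1) → ℝ) (x : ℝ) : ℝ :=
  θ (Fin.last h) + ∑ i : Fin h, v i * clipFn (w i * x + θ i.castSucc)

/-- The risk `L(θ) = ∫_a^b (N^θ(x) - f(x))² p(x) dx`. -/
def riskC {h : ℕ} (a b : ℝ) (v w : Fin h → ℝ) (f p : ℝ → ℝ) (θ : Fin (h + 1) → ℝ) : ℝ :=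
  ∫ x in Set.Ioo a b, (realC v w θ x - f x) ^ 2 * p x

/-- The gradient `∇L(θ)` as a vector of partial derivatives. -/
def gradC {h : ℕ} (a b : ℝ) (v w : Fin h → ℝ) (f p : ℝ → ℝ) (θ : Fin (h + 1) → ℝ) :
    Fin (h + 1) → ℝ :=
  fun k => fderiv ℝ (riskC a b v w f p) θ (Pi.single k 1)

/-- `x` is a descending critical point of `g` : `∇g(x) = 0` and the Hessian quadratic form
admits a negative value. -/
def IsDescCrit {n : ℕ} (g : (Fin n → ℝ) → ℝ) (x : Fin n → ℝ) : Prop :=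
  fderiv ℝ g x = 0 ∧ ∃ u : Fin n → ℝ, iteratedFDeriv ℝ 2 g x ![u, u] < 0

/-- The Euclidean norm on `Fin n → ℝ`. -/
def euclNorm {n : ℕ} (x : Fin n → ℝ) : ℝ := Real.sqrt (∑ i, (x i) ^ 2)

/-- Piecewise polynomial functions. -/
def PiecewisePoly (F : ℝ → ℝ) : Prop :=
  ∃ (K : ℕ) (τ : ℕ → EReal), 0 < K ∧ τ 0 = ⊥ ∧ τ K = ⊤ ∧
    (∀ k, k < K → τ k < τ (k + 1)) ∧
    ∀ k, k < K → ∃ q : Polynomial ℝ, ∀ x : ℝ,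
      τ k < (x : EReal) → (x : EReal) < τ (k + 1) → F x = q.eval x

/-- The derivative of the clipping function away from the kinks `0` and `1`. -/
def clipDeriv (y : ℝ) : ℝ := Set.indicator (Set.Ioo (0 : ℝ) 1) (fun _ => (1 : ℝ)) y

lemma continuous_clipFn : Continuous clipFn := by
  unfold clipFn; fun_prop

lemma clipFn_nonneg (y : ℝ) : 0 ≤ clipFn y :=
  le_min (le_max_right _ _) zero_le_one

lemma clipFn_le_one (y : ℝ) : clipFn y ≤ 1 := min_le_right _ _

lemma abs_clipFn_sub_le (y z : ℝ) : |clipFn y - clipFn z| ≤ |y - z| := by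
  unfold clipFn
  exact (abs_min_sub_min_le_max _ _ _ _).trans
    (by simpa using (abs_max_sub_max_le_max y 0 z 0))

lemma clipDeriv_nonneg (y : ℝ) : 0 ≤ clipDeriv y :=
  Set.indicator_nonneg (fun _ _ => zero_le_one) y

lemma clipDeriv_le_one (y : ℝ) : clipDeriv y ≤ 1 :=
  Set.indicator_le_self' (fun _ _ => zero_le_one) y

lemma measurable_clipDeriv : Measurable clipDeriv :=
  measurable_const.indicator measurableSet_Ioo

lemma continuousAt_clipDeriv {y : ℝ} (h0 : y ≠ 0) (h1 : y ≠ 1) : ContinuousAt clipDeriv y := by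
  refine continuousOn_const.continuousAt_indicator ?_
  simp [frontier_Ioo, h0, h1]

lemma hasDerivAt_clipFn {y : ℝ} (h0 : y ≠ 0) (h1 : y ≠ 1) :
    HasDerivAt clipFn (clipDeriv y) y := by
  rcases lt_or_gt_of_ne h0 with h | h
  · have hd : clipDeriv y = 0 := Set.indicator_of_notMem (fun hy => h.not_gt hy.1) _
    rw [hd]
    refine (hasDerivAt_const y (0 : ℝ)).congr_of_eventuallyEq ?_
    filter_upwards [Iio_mem_nhds h] with z hz
    simp [clipFn, max_eq_right (Set.mem_Iio.1 hz).le]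
  rcases lt_or_gt_of_ne h1 with h' | h'
  · have hd : clipDeriv y = 1 := Set.indicator_of_mem (Set.mem_Ioo.2 ⟨h, h'⟩) _
    rw [hd]
    refine (hasDerivAt_id y).congr_of_eventuallyEq ?_
    filter_upwards [Ioo_mem_nhds h h'] with z hz
    simp [clipFn, max_eq_left hz.1.le, min_eq_left hz.2.le]
  · have hd : clipDeriv y = 0 := Set.indicator_of_notMem (fun hy => h'.not_gt hy.2) _
    rw [hd]
    refine (hasDerivAt_const y (1 : ℝ)).congr_of_eventuallyEq ?_
    filter_upwards [Ioi_mem_nhds h'] with z hz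
    exact min_eq_right ((Set.mem_Ioi.1 hz).le.trans (le_max_left _ _))

section Realization

variable {h : ℕ} {v w : Fin h → ℝ} {f p : ℝ → ℝ}

/-- The derivative of `θ ↦ N^θ(x)` away from the kinks. -/
def realCDeriv (v w : Fin h → ℝ) (θ : Fin (h + 1) → ℝ) (x : ℝ) : (Fin (h + 1) → ℝ) →L[ℝ] ℝ :=
  ContinuousLinearMap.proj (Fin.last h) +
    ∑ i : Fin h, (v i * clipDeriv (w i * x + θ i.castSucc)) •
      ContinuousLinearMap.proj (R := ℝ) (φ := fun _ : Fin (h + 1) => ℝ) i.castSucc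

/-- The derivative of `θ ↦ (N^θ(x) - f(x))² p(x)` away from the kinks. -/
def lossDeriv (v w : Fin h → ℝ) (f p : ℝ → ℝ) (θ : Fin (h + 1) → ℝ) (x : ℝ) :
    (Fin (h + 1) → ℝ) →L[ℝ] ℝ :=
  (2 * (realC v w θ x - f x) * p x) • realCDeriv v w θ x

lemma realCDeriv_apply (θ u : Fin (h + 1) → ℝ) (x : ℝ) :
    realCDeriv v w θ x u =
      u (Fin.last h) + ∑ i, v i * clipDeriv (w i * x + θ i.castSucc) * u i.castSucc := by
  simp [realCDeriv]

lemma realCDeriv_single_last (θ : Fin (h + 1) → ℝ) (x : ℝ) :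
    realCDeriv v w θ x (Pi.single (Fin.last h) 1) = 1 := by
  simp [realCDeriv_apply, (Fin.castSucc_lt_last _).ne]

lemma realCDeriv_single_castSucc (θ : Fin (h + 1) → ℝ) (x : ℝ) (i : Fin h) :
    realCDeriv v w θ x (Pi.single i.castSucc 1) =
      v i * clipDeriv (w i * x + θ i.castSucc) := by
  simp [realCDeriv_apply, Pi.single_apply, (Fin.castSucc_lt_last _).ne']

lemma continuous_realC (θ : Fin (h + 1) → ℝ) : Continuous (realC v w θ) := by
  have := continuous_clipFn
  unfold realC; fun_prop

lemma continuous_realC_param (x : ℝ) : Continuous fun θ => realC v w θ x := by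
  have := continuous_clipFn
  unfold realC; fun_prop

lemma abs_realC_le (hv : ∀ i, 0 ≤ v i) (θ : Fin (h + 1) → ℝ) (x : ℝ) :
    |realC v w θ x| ≤ ‖θ‖ + ∑ i, v i := by
  refine (abs_add_le _ _).trans (add_le_add (norm_le_pi_norm θ _) ?_)
  rw [abs_of_nonneg (Finset.sum_nonneg fun i _ => mul_nonneg (hv i) (clipFn_nonneg _))]
  exact Finset.sum_le_sum fun i _ => mul_le_of_le_one_right (hv i) (clipFn_le_one _)

lemma abs_realC_sub_le (hv : ∀ i, 0 ≤ v i) (θ η : Fin (h + 1) → ℝ) (x : ℝ) :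
    |realC v w θ x - realC v w η x| ≤ (1 + ∑ i, v i) * ‖θ - η‖ := by
  have key : realC v w θ x - realC v w η x = (θ - η) (Fin.last h) +
      ∑ i, v i * (clipFn (w i * x + θ i.castSucc) - clipFn (w i * x + η i.castSucc)) := by
    simp only [realC, mul_sub, Finset.sum_sub_distrib, Pi.sub_apply]; ring
  rw [key, add_mul, one_mul, Finset.sum_mul]
  refine (abs_add_le _ _).trans (add_le_add (norm_le_pi_norm (θ - η) _) ?_)
  refine (Finset.abs_sum_le_sum_abs _ _).trans (Finset.sum_le_sum fun i _ => ?_)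
  rw [abs_mul, abs_of_nonneg (hv i)]
  refine mul_le_mul_of_nonneg_left ((abs_clipFn_sub_le _ _).trans ?_) (hv i)
  simpa using norm_le_pi_norm (θ - η) i.castSucc

lemma norm_realCDeriv_le (hv : ∀ i, 0 ≤ v i) (θ : Fin (h + 1) → ℝ) (x : ℝ) :
    ‖realCDeriv v w θ x‖ ≤ 1 + ∑ i, v i := by
  refine ContinuousLinearMap.opNorm_le_bound _
    (add_nonneg zero_le_one (Finset.sum_nonneg fun i _ => hv i)) fun u => ?_
  rw [realCDeriv_apply, add_mul, one_mul, Finset.sum_mul]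
  refine (norm_add_le _ _).trans (add_le_add (norm_le_pi_norm u _) ?_)
  refine (norm_sum_le _ _).trans (Finset.sum_le_sum fun i _ => ?_)
  rw [norm_mul, Real.norm_of_nonneg (mul_nonneg (hv i) (clipDeriv_nonneg _))]
  exact mul_le_mul (mul_le_of_le_one_right (hv i) (clipDeriv_le_one _)) (norm_le_pi_norm u _)
    (norm_nonneg _) (hv i)

lemma ae_ne_kink (hw : ∀ i, 0 < w i) (θ : Fin (h + 1) → ℝ) (μ : Measure ℝ) [NullSingletonClass μ] :
    ∀ᵐ x ∂μ, ∀ i, w i * x + θ i.castSucc ≠ 0 ∧ w i * x + θ i.castSucc ≠ 1 := by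
  rw [ae_all_iff]
  intro i
  have ne_ae (c : ℝ) : ∀ᵐ x ∂μ, w i * x + θ i.castSucc ≠ c := by
    filter_upwards [Measure.ae_ne μ ((c - θ i.castSucc) / w i)] with x hx hc
    apply hx
    rw [eq_div_iff (hw i).ne']
    linarith
  exact (ne_ae 0).and (ne_ae 1)

lemma hasFDerivAt_realC {θ : Fin (h + 1) → ℝ} {x : ℝ}
    (hx : ∀ i, w i * x + θ i.castSucc ≠ 0 ∧ w i * x + θ i.castSucc ≠ 1) :
    HasFDerivAt (fun η => realC v w η x) (realCDeriv v w θ x) θ := by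
  refine (hasFDerivAt_apply (Fin.last h) θ).add (HasFDerivAt.fun_sum fun i _ => ?_)
  have hlin := (hasFDerivAt_apply (𝕜 := ℝ) i.castSucc θ).const_add (w i * x)
  have := ((hasDerivAt_clipFn (hx i).1 (hx i).2).comp_hasFDerivAt θ hlin).const_mul (v i)
  rwa [smul_smul] at this

lemma hasFDerivAt_loss {θ : Fin (h + 1) → ℝ} {x : ℝ}
    (hx : ∀ i, w i * x + θ i.castSucc ≠ 0 ∧ w i * x + θ i.castSucc ≠ 1) :
    HasFDerivAt (fun η => (realC v w η x - f x) ^ 2 * p x) (lossDeriv v w f p θ x) θ := by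
  refine ((((hasFDerivAt_realC (v := v) hx).sub_const (f x)).pow 2).mul_const (p x)).congr_fderiv ?_
  ext u
  simp [lossDeriv]
  ring

lemma continuousAt_lossDeriv {θ : Fin (h + 1) → ℝ} {x : ℝ}
    (hx : ∀ i, w i * x + θ i.castSucc ≠ 0 ∧ w i * x + θ i.castSucc ≠ 1) :
    ContinuousAt (fun η => lossDeriv v w f p η x) θ := by
  have hreal : ContinuousAt (fun η => realC v w η x) θ := (continuous_realC_param x).continuousAt
  have hclip (i : Fin h) : ContinuousAt
      (fun η : Fin (h + 1) → ℝ => clipDeriv (w i * x + η i.castSucc)) θ :=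
    ContinuousAt.comp (f := fun η : Fin (h + 1) → ℝ => w i * x + η i.castSucc)
      (continuousAt_clipDeriv (hx i).1 (hx i).2)
      (continuous_const.add (continuous_apply i.castSucc)).continuousAt
  exact (((hreal.sub continuousAt_const).const_mul 2).mul_const (p x)).smul
    (continuousAt_const.add (tendsto_finsetSum _ fun i _ =>
      ((hclip i).const_mul (v i)).smul continuousAt_const))

lemma stronglyMeasurable_lossDeriv (hf : Continuous f) (hp : Continuous p)
    (θ : Fin (h + 1) → ℝ) : StronglyMeasurable (lossDeriv v w f p θ) := by
  have hreal := continuous_realC (v := v) (w := w) θ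
  have hclip (i : Fin h) : Measurable fun x => v i * clipDeriv (w i * x + θ i.castSucc) :=
    (measurable_clipDeriv.comp (by fun_prop)).const_mul _
  refine StronglyMeasurable.smul
    (((hreal.sub hf).const_mul 2).mul hp).stronglyMeasurable ?_
  exact stronglyMeasurable_const.add (Finset.stronglyMeasurable_fun_sum _ fun i _ =>
    (hclip i).stronglyMeasurable.smul_const _)

/-- A bound for `lossDeriv` and for the Lipschitz constant of the loss, valid for all parameters
of norm at most `R`. -/
def lossBound (v : Fin h → ℝ) (f p : ℝ → ℝ) (R x : ℝ) : ℝ :=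
  2 * (R + ∑ i, v i + |f x|) * p x * (1 + ∑ i, v i)

lemma abs_realC_sub_target_le (hv : ∀ i, 0 ≤ v i) {R : ℝ} {θ : Fin (h + 1) → ℝ} (hθ : ‖θ‖ ≤ R)
    (x : ℝ) : |realC v w θ x - f x| ≤ R + ∑ i, v i + |f x| :=
  (abs_sub _ _).trans (by linarith [abs_realC_le (w := w) hv θ x])

lemma norm_lossDeriv_le (hv : ∀ i, 0 ≤ v i) (hp : ∀ x, 0 ≤ p x) {R : ℝ} {θ : Fin (h + 1) → ℝ}
    (hθ : ‖θ‖ ≤ R) (x : ℝ) : ‖lossDeriv v w f p θ x‖ ≤ lossBound v f p R x := by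
  rw [lossDeriv, norm_smul, norm_mul, norm_mul, Real.norm_of_nonneg (hp x), Real.norm_two]
  have hN : ‖realC v w θ x - f x‖ ≤ _ := abs_realC_sub_target_le (w := w) (f := f) hv hθ x
  have := hp x
  have := (norm_nonneg _).trans hN
  exact mul_le_mul (by gcongr) (norm_realCDeriv_le hv θ x) (norm_nonneg _) (by positivity)

lemma abs_loss_sub_le (hv : ∀ i, 0 ≤ v i) (hp : ∀ x, 0 ≤ p x) {R : ℝ} {θ η : Fin (h + 1) → ℝ}
    (hθ : ‖θ‖ ≤ R) (hη : ‖η‖ ≤ R) (x : ℝ) :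
    |(realC v w θ x - f x) ^ 2 * p x - (realC v w η x - f x) ^ 2 * p x| ≤
      lossBound v f p R x * ‖θ - η‖ := by
  have key : (realC v w θ x - f x) ^ 2 * p x - (realC v w η x - f x) ^ 2 * p x =
      ((realC v w θ x - f x) + (realC v w η x - f x)) * p x *
        (realC v w θ x - realC v w η x) := by ring
  have hθ' := abs_realC_sub_target_le (w := w) (f := f) hv hθ x
  have hη' := abs_realC_sub_target_le (w := w) (f := f) hv hη x
  have hsum := (abs_add_le (realC v w θ x - f x) (realC v w η x - f x)).trans
    ((add_le_add hθ' hη').trans_eq (two_mul _).symm)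
  have := hp x
  have := (abs_nonneg _).trans hθ'
  rw [key, abs_mul, abs_mul, abs_of_nonneg (hp x), lossBound, mul_assoc (2 * _ * _)]
  exact mul_le_mul (by gcongr) (abs_realC_sub_le hv θ η x) (abs_nonneg _) (by positivity)

lemma Continuous.integrableOn_Ioo {g : ℝ → ℝ} (hg : Continuous g) (a b : ℝ) :
    IntegrableOn g (Set.Ioo a b) :=
  hg.integrableOn_Icc.mono_set Set.Ioo_subset_Icc_self

lemma integrableOn_lossBound (hf : Continuous f) (hp : Continuous p) (a b R : ℝ) :
    IntegrableOn (lossBound v f p R) (Set.Ioo a b) :=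
  Continuous.integrableOn_Ioo (by unfold lossBound; fun_prop) a b

lemma norm_le_of_mem_ball {θ η : Fin (h + 1) → ℝ} (hη : η ∈ Metric.ball θ 1) :
    ‖η‖ ≤ ‖θ‖ + 1 := by
  have := norm_le_norm_add_norm_sub' η θ
  rw [mem_ball_iff_norm] at hη
  linarith

lemma integrableOn_and_hasFDerivAt_riskC (hv : ∀ i, 0 ≤ v i) (hw : ∀ i, 0 < w i)
    (hf : Continuous f) (hp : Continuous p) (hp0 : ∀ x, 0 ≤ p x) (a b : ℝ)
    (θ : Fin (h + 1) → ℝ) :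
    IntegrableOn (lossDeriv v w f p θ) (Set.Ioo a b) ∧
      HasFDerivAt (riskC a b v w f p) (∫ x in Set.Ioo a b, lossDeriv v w f p θ x) θ := by
  have hcont (η : Fin (h + 1) → ℝ) : Continuous fun x => (realC v w η x - f x) ^ 2 * p x := by
    have := continuous_realC (v := v) (w := w) η
    fun_prop
  refine hasFDerivAt_integral_of_dominated_loc_of_lip (Metric.ball_mem_nhds θ one_pos)
    (.of_forall fun η => (hcont η).aestronglyMeasurable) ((hcont θ).integrableOn_Ioo a b)
    (stronglyMeasurable_lossDeriv hf hp θ).aestronglyMeasurable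
    (.of_forall fun x => LipschitzOnWith.of_dist_le_mul fun η hη ξ hξ => ?_)
    (integrableOn_lossBound (v := v) hf hp a b (‖θ‖ + 1)) ?_
  · rw [Real.dist_eq, dist_eq_norm, Real.coe_nnabs]
    exact (abs_loss_sub_le hv hp0 (norm_le_of_mem_ball hη) (norm_le_of_mem_ball hξ) x).trans
      (mul_le_mul_of_nonneg_right (le_abs_self _) (norm_nonneg _))
  · filter_upwards [ae_ne_kink hw θ _] with x hx using hasFDerivAt_loss hx

lemma continuous_integral_lossDeriv (hv : ∀ i, 0 ≤ v i) (hw : ∀ i, 0 < w i)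
    (hf : Continuous f) (hp : Continuous p) (hp0 : ∀ x, 0 ≤ p x) (a b : ℝ) :
    Continuous fun θ => ∫ x in Set.Ioo a b, lossDeriv v w f p θ x := by
  refine continuous_iff_continuousAt.2 fun θ => ?_
  refine continuousAt_of_dominated
    (.of_forall fun η => (stronglyMeasurable_lossDeriv hf hp η).aestronglyMeasurable) ?_
    (integrableOn_lossBound (v := v) hf hp a b (‖θ‖ + 1)) ?_
  · filter_upwards [Metric.ball_mem_nhds θ one_pos] with η hη
    exact .of_forall (norm_lossDeriv_le hv hp0 (norm_le_of_mem_ball hη))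
  · filter_upwards [ae_ne_kink hw θ _] with x hx using continuousAt_lossDeriv hx

lemma hasDerivAt_riskC_update (hv : ∀ i, 0 ≤ v i) (hw : ∀ i, 0 < w i)
    (hf : Continuous f) (hp : Continuous p) (hp0 : ∀ x, 0 ≤ p x) (a b : ℝ)
    (θ : Fin (h + 1) → ℝ) (k : Fin (h + 1)) :
    HasDerivAt (fun s => riskC a b v w f p (Function.update θ k s))
      (∫ x in Set.Ioo a b, lossDeriv v w f p θ x (Pi.single k 1)) (θ k) := by
  obtain ⟨hint, hder⟩ := integrableOn_and_hasFDerivAt_riskC hv hw hf hp hp0 a b θ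
  rw [← ContinuousLinearMap.integral_apply hint]
  exact HasFDerivAt.comp_hasDerivAt (θ k) (by rwa [Function.update_eq_self])
    (hasDerivAt_update θ k (θ k))

lemma actI_eq (hw : ∀ i, 0 < w i) (a b : ℝ) (θ : Fin (h + 1) → ℝ) (i : Fin h) :
    actI a b w θ i = Set.Ioo a b ∩ (fun x => w i * x + θ i.castSucc) ⁻¹' Set.Ioo 0 1 := by
  rw [actI, Set.inter_comm]
  congr 1
  ext x
  have hadd : psiC w θ i + (w i)⁻¹ = (1 - θ i.castSucc) / w i := by
    rw [psiC]; ring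
  rw [Set.mem_preimage, Set.mem_Ioo, Set.mem_Ioo, hadd, psiC, div_lt_iff₀' (hw i),
    lt_div_iff₀' (hw i)]
  constructor <;> rintro ⟨_, _⟩ <;> constructor <;> linarith

lemma setIntegral_mul_indicator_eq_actI (hw : ∀ i, 0 < w i) (a b : ℝ) (θ : Fin (h + 1) → ℝ)
    (i : Fin h) (g : ℝ → ℝ) :
    ∫ x in Set.Ioo a b,
        g x * Set.indicator (Set.Ioo (0 : ℝ) 1) (fun _ => (1 : ℝ)) (w i * x + θ i.castSucc) =
      ∫ x in actI a b w θ i, g x := by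
  have hmeas : Measurable fun x : ℝ => w i * x + θ i.castSucc := by fun_prop
  rw [actI_eq hw, ← setIntegral_indicator (hmeas measurableSet_Ioo)]
  congr 1 with x
  by_cases hx : w i * x + θ i.castSucc ∈ Set.Ioo (0 : ℝ) 1
  · rw [Set.indicator_of_mem hx, mul_one]
    exact (Set.indicator_of_mem (s := (fun x => w i * x + θ i.castSucc) ⁻¹' _) hx g).symm
  · rw [Set.indicator_of_notMem hx, mul_zero]
    exact (Set.indicator_of_notMem (s := (fun x => w i * x + θ i.castSucc) ⁻¹' _) hx g).symm

end Realization

theorem statement_2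
    (a b : ℝ) (hab : a < b) (h : ℕ) (hh : 0 < h)
    (v w : Fin h → ℝ) (hv : ∀ i, 0 < v i) (hw : ∀ i, 0 < w i)
    (f p : ℝ → ℝ) (hf : Continuous f) (hp : Continuous p)
    (hpnn : ∀ x : ℝ, 0 ≤ p x) (hsupp : {x : ℝ | 0 < p x} = Set.Ioo a b) :
    ContDiff ℝ 1 (riskC a b v w f p) ∧
    (∀ θ : Fin (h + 1) → ℝ, ∀ i : Fin h,
      HasDerivAt (fun s => riskC a b v w f p (Function.update θ i.castSucc s))
        (2 * v i * ∫ x in Set.Ioo a b,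
          (realC v w θ x - f x) * p x *
            Set.indicator (Set.Ioo (0 : ℝ) 1) (fun _ => (1 : ℝ)) (w i * x + θ i.castSucc))
        (θ i.castSucc) ∧
      2 * v i * (∫ x in Set.Ioo a b,
          (realC v w θ x - f x) * p x *
            Set.indicator (Set.Ioo (0 : ℝ) 1) (fun _ => (1 : ℝ)) (w i * x + θ i.castSucc))
        = 2 * v i * ∫ x in actI a b w θ i, (realC v w θ x - f x) * p x) ∧
    (∀ θ : Fin (h + 1) → ℝ,
      HasDerivAt (fun s => riskC a b v w f p (Function.update θ (Fin.last h) s))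
        (2 * ∫ x in Set.Ioo a b, (realC v w θ x - f x) * p x) (θ (Fin.last h))) := by
  have hv0 (i : Fin h) : 0 ≤ v i := (hv i).le
  refine ⟨contDiff_one_iff_hasFDerivAt.2 ⟨_, continuous_integral_lossDeriv hv0 hw hf hp hpnn a b,
    fun θ => (integrableOn_and_hasFDerivAt_riskC hv0 hw hf hp hpnn a b θ).2⟩,
    fun θ i => ⟨?_, by rw [setIntegral_mul_indicator_eq_actI hw]⟩, fun θ => ?_⟩
  · refine (hasDerivAt_riskC_update hv0 hw hf hp hpnn a b θ i.castSucc).congr_deriv ?_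
    rw [← integral_const_mul]
    congr 1 with x
    rw [lossDeriv, smul_apply, realCDeriv_single_castSucc, clipDeriv,
      smul_eq_mul]
    ring
  · refine (hasDerivAt_riskC_update hv0 hw hf hp hpnn a b θ (Fin.last h)).congr_deriv ?_
    rw [← integral_const_mul]
    congr 1 with x
    rw [lossDeriv, smul_apply, realCDeriv_single_last, smul_eq_mul]
    ring
end
end

section
/- Let a ∈ ℝ, b ∈ (a, ∞), let p ∈ C([a, b], [0, ∞)) be strictly monotone (strictly increasing or strictly decreasing), let g ∈ C([a, b], ℝ) and L ∈ (0, ∞) satisfy for all x, y ∈ [a, b] with x < y that g(y) − g(x) > 3L(y − x), and assume ∫_a^b g(x) p(x) dx = 0. Then L ∫_a^b p(x) dx < g(b) p(b) − g(a) p(a). -/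
open MeasureTheory

/-- The integral over `[a, b]` of a nonnegative constant supported on `[d, b]` is at most the
constant times `b - d`. -/
lemma setIntegral_Icc_indicator_const_le {a b d k : ℝ} (hd : d ≤ b) (hk : 0 ≤ k) :
    ∫ x in Set.Icc a b, (Set.Icc d b).indicator (fun _ => k) x ≤ (b - d) * k := by
  rw [setIntegral_indicator measurableSet_Icc, setIntegral_const, smul_eq_mul]
  refine mul_le_mul_of_nonneg_right ?_ hk
  calc volume.real (Set.Icc a b ∩ Set.Icc d b) ≤ volume.real (Set.Icc d b) :=
        measureReal_mono Set.inter_subset_right (by simp)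
    _ = b - d := Real.volume_real_Icc_of_le hd

/-- If `g` grows with slope greater than `3 * L`, `p` is nonnegative and strictly increasing, and
`g * p` has integral zero, then `g` vanishes at a point of `(a, b)`. -/
lemma exists_zero_of_setIntegral_mul_eq_zero
    {a b : ℝ} (hab : a < b) {p g : ℝ → ℝ}
    (hp : ContinuousOn p (Set.Icc a b)) (hpnn : ∀ x ∈ Set.Icc a b, 0 ≤ p x)
    (hmono : StrictMonoOn p (Set.Icc a b)) (hg : ContinuousOn g (Set.Icc a b))
    (hgmono : StrictMonoOn g (Set.Icc a b))
    (hint : ∫ x in Set.Icc a b, g x * p x = 0) : ∃ c ∈ Set.Ioo a b, g c = 0 := by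
  have ha : a ∈ Set.Icc a b := ⟨le_rfl, hab.le⟩
  have hb : b ∈ Set.Icc a b := ⟨hab.le, le_rfl⟩
  have hm : (a + b) / 2 ∈ Set.Icc a b := ⟨by linarith, by linarith⟩
  have hpm : 0 < p ((a + b) / 2) := (hpnn a ha).trans_lt (hmono ha hm (by linarith))
  rw [integral_Icc_eq_integral_Ioc, ← intervalIntegral.integral_of_le hab.le] at hint
  have hga : g a < 0 := by
    by_contra! h
    have := intervalIntegral.integral_pos hab (hg.mul hp)
      (fun x hx => mul_nonneg (h.trans (hgmono.monotoneOn ha ⟨hx.1.le, hx.2⟩ hx.1.le))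
        (hpnn x ⟨hx.1.le, hx.2⟩))
      ⟨_, hm, mul_pos (h.trans_lt (hgmono ha hm (by linarith))) hpm⟩
    exact this.ne' hint
  have hgb : 0 < g b := by
    by_contra! h
    have := intervalIntegral.integral_pos hab (hg.mul hp).neg
      (fun x hx => neg_nonneg.2 (mul_nonpos_of_nonpos_of_nonneg
        ((hgmono.monotoneOn ⟨hx.1.le, hx.2⟩ hb hx.2).trans h) (hpnn x ⟨hx.1.le, hx.2⟩)))
      ⟨_, hm, neg_pos.2 (mul_neg_of_neg_of_pos
        ((hgmono hm hb (by linarith)).trans_le h) hpm)⟩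
    simp only [Pi.neg_apply, Pi.mul_apply, intervalIntegral.integral_neg] at this
    exact (neg_pos.1 this).ne hint
  exact intermediate_value_Ioo hab.le hg ⟨hga, hgb⟩

lemma mul_setIntegral_lt_of_strictMonoOn
    {a b : ℝ} (hab : a < b) {p g : ℝ → ℝ} {L : ℝ}
    (hp : ContinuousOn p (Set.Icc a b)) (hpnn : ∀ x ∈ Set.Icc a b, 0 ≤ p x)
    (hmono : StrictMonoOn p (Set.Icc a b))
    (hg : ContinuousOn g (Set.Icc a b)) (hL : 0 < L)
    (hslope : ∀ x ∈ Set.Icc a b, ∀ y ∈ Set.Icc a b, x < y → 3 * L * (y - x) < g y - g x)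
    (hint : ∫ x in Set.Icc a b, g x * p x = 0) :
    L * ∫ x in Set.Icc a b, p x < g b * p b - g a * p a := by
  have ha : a ∈ Set.Icc a b := ⟨le_rfl, hab.le⟩
  have hb : b ∈ Set.Icc a b := ⟨hab.le, le_rfl⟩
  have hgmono : StrictMonoOn g (Set.Icc a b) := fun x hx y hy hxy => by
    have := hslope x hx y hy hxy
    have : 0 < 3 * L * (y - x) := mul_pos (by positivity) (sub_pos.2 hxy)
    linarith
  obtain ⟨c, ⟨hac, hcb⟩, hgc⟩ :=
    exists_zero_of_setIntegral_mul_eq_zero hab hp hpnn hmono hg hgmono hint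
  have hc : c ∈ Set.Icc a b := ⟨hac.le, hcb.le⟩
  have hga : g a < 0 := hgc ▸ hgmono ha hc hac
  have hgb : 3 * L * (b - c) < g b := by simpa [hgc] using hslope c hc b hb hcb
  have hgb0 : 0 < g b := hgc ▸ hgmono hc hb hcb
  have hpb : 0 < p b := (hpnn a ha).trans_lt (hmono ha hb hab)
  have hu : 0 < b - c := sub_pos.2 hcb
  have pointwise : ∀ x ∈ Set.Icc a b, 3 * L * (b - c) * p x + g x * p x ≤
      (Set.Icc (c - (b - c)) b).indicator (fun _ => 3 * L * (b - c) * p b) x +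
        (Set.Icc c b).indicator (fun _ => g b * p b) x := by
    intro x hx
    have hpx := hpnn x hx
    have hpxb : p x ≤ p b := hmono.monotoneOn hx hb hx.2
    have hbound : 3 * L * (b - c) * p x ≤ 3 * L * (b - c) * p b := by gcongr
    rcases le_or_gt c x with hcx | hxc
    · rw [Set.indicator_of_mem (show x ∈ Set.Icc (c - (b - c)) b from ⟨by linarith, hx.2⟩),
        Set.indicator_of_mem (show x ∈ Set.Icc c b from ⟨hcx, hx.2⟩)]
      have hgx : g x ≤ g b := hgmono.monotoneOn hx hb hx.2
      have : g x * p x ≤ g b * p b := mul_le_mul hgx hpxb hpx hgb0.le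
      linarith
    · rw [Set.indicator_of_notMem (show x ∉ Set.Icc c b from fun h => absurd h.1 hxc.not_ge),
        add_zero]
      have hgx : 3 * L * (c - x) < -g x := by simpa [hgc] using hslope x hx c hc hxc
      rcases le_or_gt (c - (b - c)) x with hdx | hxd
      · rw [Set.indicator_of_mem (show x ∈ Set.Icc (c - (b - c)) b from ⟨hdx, hx.2⟩)]
        have : g x ≤ 0 := hgc ▸ (hgmono hx hc hxc).le
        have : g x * p x ≤ 0 := mul_nonpos_of_nonpos_of_nonneg this hpx
        linarith
      · rw [Set.indicator_of_notMem
          (show x ∉ Set.Icc (c - (b - c)) b from fun h => absurd h.1 hxd.not_ge), ← add_mul]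
        refine mul_nonpos_of_nonpos_of_nonneg ?_ hpx
        have : 3 * L * (b - c) ≤ 3 * L * (c - x) :=
          mul_le_mul_of_nonneg_left (by linarith) (by positivity)
        linarith
  have hpi : IntegrableOn p (Set.Icc a b) := hp.integrableOn_Icc
  have hgpi : IntegrableOn (fun x => g x * p x) (Set.Icc a b) := (hg.mul hp).integrableOn_Icc
  have hindi : ∀ d k : ℝ,
      IntegrableOn ((Set.Icc d b).indicator fun _ => k) (Set.Icc a b) := fun d k =>
    (integrable_const k).indicator measurableSet_Icc
  have key := setIntegral_mono_on ((hpi.const_mul (3 * L * (b - c))).add hgpi)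
    ((hindi _ _).add (hindi _ _)) measurableSet_Icc pointwise
  simp only [Pi.add_apply] at key
  rw [integral_add (hpi.const_mul _) hgpi, integral_add (hindi _ _) (hindi _ _), hint,
    integral_const_mul, add_zero] at key
  have h₁ := setIntegral_Icc_indicator_const_le (a := a) (b := b) (d := c - (b - c))
    (k := 3 * L * (b - c) * p b) (by linarith) (by positivity)
  have h₂ := setIntegral_Icc_indicator_const_le (a := a) (b := b) (d := c)
    (k := g b * p b) hcb.le (by positivity)
  have h₃ : (b - c) * (3 * (L * ∫ x in Set.Icc a b, p x)) ≤
      (b - c) * (2 * (3 * L * (b - c) * p b) + g b * p b) := by linarith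
  have h₄ := le_of_mul_le_mul_left h₃ hu
  have h₅ : 3 * L * (b - c) * p b < g b * p b := mul_lt_mul_of_pos_right hgb hpb
  have h₆ : g a * p a ≤ 0 := mul_nonpos_of_nonpos_of_nonneg hga.le (hpnn a ha)
  linarith

lemma setIntegral_Icc_comp_neg {a b : ℝ} (hab : a ≤ b) (f : ℝ → ℝ) :
    ∫ x in Set.Icc (-b) (-a), f (-x) = ∫ x in Set.Icc a b, f x := by
  rw [integral_Icc_eq_integral_Ioc, integral_Icc_eq_integral_Ioc,
    ← intervalIntegral.integral_of_le (neg_le_neg hab), ← intervalIntegral.integral_of_le hab,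
    intervalIntegral.integral_comp_neg, neg_neg, neg_neg]

theorem statement_6
    (a b : ℝ) (hab : a < b) (p g : ℝ → ℝ) (L : ℝ)
    (hp : ContinuousOn p (Set.Icc a b)) (hpnn : ∀ x ∈ Set.Icc a b, 0 ≤ p x)
    (hmono : StrictMonoOn p (Set.Icc a b) ∨ StrictAntiOn p (Set.Icc a b))
    (hg : ContinuousOn g (Set.Icc a b)) (hL : 0 < L)
    (hslope : ∀ x ∈ Set.Icc a b, ∀ y ∈ Set.Icc a b, x < y → 3 * L * (y - x) < g y - g x)
    (hint : ∫ x in Set.Icc a b, g x * p x = 0) :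
    L * ∫ x in Set.Icc a b, p x < g b * p b - g a * p a := by
  rcases hmono with hmono | hanti
  · exact mul_setIntegral_lt_of_strictMonoOn hab hp hpnn hmono hg hL hslope hint
  · have hmaps : Set.MapsTo (fun x : ℝ => -x) (Set.Icc (-b) (-a)) (Set.Icc a b) :=
      fun x hx => ⟨by linarith [hx.2], by linarith [hx.1]⟩
    have key := mul_setIntegral_lt_of_strictMonoOn (p := fun x => p (-x))
      (g := fun x => -g (-x)) (neg_lt_neg hab) (hp.comp continuousOn_neg hmaps)
      (fun x hx => hpnn _ (hmaps hx))
      (fun x hx y hy hxy => hanti (hmaps hy) (hmaps hx) (neg_lt_neg hxy))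
      (hg.comp continuousOn_neg hmaps).neg hL
      (fun x hx y hy hxy => by
        have := hslope _ (hmaps hy) _ (hmaps hx) (neg_lt_neg hxy)
        linarith)
      (by
        rw [setIntegral_Icc_comp_neg hab.le fun x => -g x * p x]
        simp only [neg_mul, integral_neg, hint, neg_zero])
    rw [setIntegral_Icc_comp_neg hab.le p] at key
    simp only [neg_neg] at key
    linarith
end
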